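/- Let G be a finitely generated group, K a subgroup of G of finite index, and Φ an automorphism of G. Then there exists k ≥ 1 such that the image subgroup Φ^k(K) equals K. -/

import Mathlib

open scoped Pointwise

/-- A finitely generated group admits only finitely many homomorphisms to a given finite group. -/
theorem MonoidHom.finite_of_group_fg {G H : Type*} [Group G] [Group.FG G] [Group H] [Finite H] :
    Finite (G →* H) := by
  obtain ⟨S, hS⟩ := Group.fg_def.mp (inferInstance : Group.FG G)
  refine Finite.of_injective (fun (f : G →* H) (s : S) => f s) fun f g hfg => ?_
  exact MonoidHom.eq_of_eqOn_dense hS fun s hs => congrFun hfg ⟨s, hs⟩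

/-- A subgroup of finite index is a point stabilizer for some action on `Fin K.index`. -/
theorem Subgroup.exists_comap_stabilizer_eq {G : Type*} [Group G] (K : Subgroup G)
    (hK : K.index ≠ 0) : ∃ (f : G →* Equiv.Perm (Fin K.index)) (i : Fin K.index),
      (MulAction.stabilizer (Equiv.Perm (Fin K.index)) i).comap f = K := by
  have : Finite (G ⧸ K) := Nat.finite_of_card_ne_zero hK
  let e : G ⧸ K ≃ Fin K.index := Finite.equivFin (G ⧸ K)
  refine ⟨e.permCongrHom.toMonoidHom.comp (MulAction.toPermHom G (G ⧸ K)), e (1 : G), ?_⟩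
  ext g
  simp [Equiv.permCongrHom, QuotientGroup.eq]

/-- A finitely generated group has only finitely many subgroups of a given nonzero index. -/
theorem Subgroup.finite_setOf_index_eq {G : Type*} [Group G] [Group.FG G] {n : ℕ} (hn : n ≠ 0) :
    {K : Subgroup G | K.index = n}.Finite := by
  have := MonoidHom.finite_of_group_fg (G := G) (H := Equiv.Perm (Fin n))
  refine (Set.finite_range fun p : (G →* Equiv.Perm (Fin n)) × Fin n =>
    (MulAction.stabilizer (Equiv.Perm (Fin n)) p.2).comap p.1).subset ?_
  rintro K rfl
  obtain ⟨f, i, h⟩ := K.exists_comap_stabilizer_eq hn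
  exact ⟨(f, i), h⟩

/-- If `G` is finitely generated, `K ≤ G` has finite index and `Φ` is an
automorphism of `G`, then some positive power of `Φ` maps `K` onto `K`. -/
theorem exists_pow_map_eq_of_finiteIndex {G : Type*} [Group G] [Group.FG G]
    (K : Subgroup G) (hK : K.index ≠ 0) (Φ : MulAut G) :
    ∃ k : ℕ, 1 ≤ k ∧ Subgroup.map (Φ ^ k : MulAut G).toMonoidHom K = K := by
  have hmem (k : ℕ) : Φ ^ k • K ∈ {L : Subgroup G | L.index = K.index} :=
    K.index_map_equiv (Φ ^ k)
  obtain ⟨i, j, hij, h⟩ := (Subgroup.finite_setOf_index_eq hK).exists_lt_map_eq_of_forall_mem hmem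
  refine ⟨j - i, by lia, ?_⟩
  change Φ ^ (j - i) • K = K
  rw [← Nat.add_sub_of_le hij.le, pow_add, mul_smul] at h
  exact (smul_left_cancel _ h).symm
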